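/- There exists η > 0 depending only on a, b, c such that for every continuous map Q from the closed unit ball of ℝ³ to S₀ satisfying Q(x) = s_*( x⊗x − (1/3)I ) for all x in the unit sphere, there exists a point y in the open unit ball with f(Q(y)) ≥ η. -/

import Mathlib

noncomputable section

open Matrix MeasureTheory Metric Set

attribute [local instance] Matrix.normedAddCommGroup Matrix.normedSpace

abbrev E3 : Type := EuclideanSpace ℝ (Fin 3)
abbrev M3 : Type := Matrix (Fin 3) (Fin 3) ℝ

/-- The space of symmetric traceless real 3×3 matrices. -/
def S0 : Set M3 := {Q | Q.IsSymm ∧ Q.trace = 0}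

def sstar (a b c : ℝ) : ℝ := (b + Real.sqrt (b ^ 2 + 24 * a * c)) / (4 * c)

def kconst (a b c : ℝ) : ℝ :=
  sstar a b c ^ 2 / 27 * (9 * a + 2 * b * sstar a b c - 3 * c * sstar a b c ^ 2)

/-- Bulk potential. -/
def fbulk (a b c : ℝ) (Q : M3) : ℝ :=
  kconst a b c - a / 2 * (Q * Q).trace - b / 3 * (Q * Q * Q).trace
    + c / 4 * ((Q * Q).trace) ^ 2

/-- Partial derivative `∂ₖ Q` (componentwise). -/
def pd (Q : E3 → M3) (k : Fin 3) (x : E3) : M3 :=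
  Matrix.of fun i j => fderiv ℝ (fun y => Q y i j) x (EuclideanSpace.single k 1)

/-- Squared Frobenius norm of a matrix. -/
def frobSq (A : M3) : ℝ := ∑ i, ∑ j, (A i j) ^ 2

def frobNorm (A : M3) : ℝ := Real.sqrt (frobSq A)

/-- `|∇Q|²`. -/
def gradSq (Q : E3 → M3) (x : E3) : ℝ := ∑ k : Fin 3, frobSq (pd Q k x)

/-- Energy density `e_ε(Q)`. -/
def eDen (a b c ε : ℝ) (Q : E3 → M3) (x : E3) : ℝ :=
  1 / 2 * gradSq Q x + 1 / ε ^ 2 * fbulk a b c (Q x)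

/-- Energy `E_ε(Q, U)`. -/
def energy (a b c ε : ℝ) (Q : E3 → M3) (U : Set E3) : ℝ :=
  ∫ x in U, eDen a b c ε Q x

/-- Componentwise Laplacian. -/
def lapM (Q : E3 → M3) (x : E3) : M3 :=
  ∑ k : Fin 3, Matrix.of fun i j =>
    fderiv ℝ (fun y => pd Q k y i j) x (EuclideanSpace.single k 1)

/-- `|Q|² = tr(Q²)`. -/
def normSqM (Q : M3) : ℝ := (Q * Q).trace

/-- The Euler–Lagrange equation at a point. -/
def ELeq (a b c ε : ℝ) (Q : E3 → M3) (x : E3) : Prop :=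
  (-(ε ^ 2)) • lapM Q x - a • Q x - b • (Q x * Q x)
    + (b / 3 * normSqM (Q x)) • (1 : M3) + (c * normSqM (Q x)) • Q x = 0

/-- Local minimizer of the Landau–de Gennes energy on an open set `ω`. -/
def IsLDGMin (a b c ε : ℝ) (ω : Set E3) (Q : E3 → M3) : Prop :=
  ∀ (x : E3) (r : ℝ), 0 < r → closedBall x r ⊆ ω →
    ∀ P : E3 → M3, ContDiffOn ℝ (⊤ : ℕ∞) P ω → (∀ y ∈ ω, P y ∈ S0) →
      (∃ K : Set E3, IsCompact K ∧ K ⊆ ball x r ∧ ∀ y ∉ K, P y = Q y) →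
      energy a b c ε Q (ball x r) ≤ energy a b c ε P (ball x r)

/-- The vacuum manifold `N`. -/
def Nman (a b c : ℝ) : Set M3 :=
  {P | ∃ n : Fin 3 → ℝ, (∑ i, (n i) ^ 2) = 1 ∧
    P = sstar a b c • (Matrix.vecMulVec n n - (1 / 3 : ℝ) • (1 : M3))}

/-- Frobenius distance to the vacuum manifold. -/
def distN (a b c : ℝ) (Q : M3) : ℝ :=
  sInf ((fun P => frobNorm (Q - P)) '' Nman a b c)

/-- Directional derivative `v·∇Q = Σₖ vₖ ∂ₖQ`. -/
def dirD (Q : E3 → M3) (v : E3) (x : E3) : M3 := ∑ k : Fin 3, v k • pd Q k x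

/-- Admissible cutoff profile. -/
def AdmissibleCutoff (φ : ℝ → ℝ) : Prop :=
  ContDiff ℝ (⊤ : ℕ∞) φ ∧ (∀ t, 0 ≤ φ t) ∧ (∀ t, 10 ≤ t → φ t = 0) ∧
    (∀ t ∈ Icc (0 : ℝ) 8, 1 ≤ φ t) ∧ φ 0 = 60 ∧
    (∀ t, 0 ≤ t → |deriv φ t| ≤ 100) ∧
    (∀ t ∈ Icc (0 : ℝ) 8, deriv φ t ∈ Icc (-2 : ℝ) (-1)) ∧
    (∀ t, 0 ≤ t → deriv φ t ≤ 0)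

/-- The density `Θ_ρ^φ(Q, x)`. -/
def Theta (a b c ε : ℝ) (φ : ℝ → ℝ) (Q : E3 → M3) (x : E3) (ρ : ℝ) : ℝ :=
  ρ⁻¹ * ∫ y in ball x (Real.sqrt 10 * ρ), eDen a b c ε Q y * φ (‖y - x‖ ^ 2 / ρ ^ 2)

/-- The regular scale `r(Q, x)`. -/
def regScale (a b c ε : ℝ) (Q : E3 → M3) (x : E3) : ℝ :=
  sSup {ρ : ℝ | 0 ≤ ρ ∧ ρ ≤ 1 ∧ ∀ y ∈ ball x ρ, ρ ^ 2 * eDen a b c ε Q y ≤ 1}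

/-- The bad set `Bad(Q; s, δ)`. -/
def badSet (a b c ε : ℝ) (Q : E3 → M3) (s δ : ℝ) : Set E3 :=
  {y | regScale a b c ε Q y < s} ∪ {y | δ < distN a b c (Q y)}


/-- Matrix entries of a linear map. -/
def ent (L : E3 →L[ℝ] E3) (i j : Fin 3) : ℝ := (L (EuclideanSpace.single j 1)) i

lemma ent_cont (i j : Fin 3) : Continuous (fun L => ent L i j) := by
  unfold ent
  fun_prop

lemma det_eq_ent (L : E3 →L[ℝ] E3) : L.det = (Matrix.of (ent L)).det := by
  have : Matrix.of (ent L) = LinearMap.toMatrix (EuclideanSpace.basisFun (Fin 3) ℝ).toBasis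
      (EuclideanSpace.basisFun (Fin 3) ℝ).toBasis (L : E3 →ₗ[ℝ] E3) := by
    ext i j
    simp [ent, LinearMap.toMatrix_apply]
  rw [this, LinearMap.det_toMatrix]

lemma det_expand : ∃ q1 q2 q3 : (E3 →L[ℝ] E3) → ℝ, Continuous q1 ∧ Continuous q2 ∧ Continuous q3 ∧
    ∀ (L : E3 →L[ℝ] E3) (t : ℝ),
      (ContinuousLinearMap.id ℝ E3 + t • L).det = 1 + t * q1 L + t ^ 2 * q2 L + t ^ 3 * q3 L := by
  have hc := ent_cont
  refine ⟨fun L => ent L 0 0 + ent L 1 1 + ent L 2 2,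
    fun L => ent L 0 0 * ent L 1 1 + ent L 0 0 * ent L 2 2 + ent L 1 1 * ent L 2 2
      - ent L 0 1 * ent L 1 0 - ent L 0 2 * ent L 2 0 - ent L 1 2 * ent L 2 1,
    fun L => (Matrix.of (ent L)).det, ?_, ?_, ?_, ?_⟩
  · fun_prop
  · fun_prop
  · simp only [Matrix.det_fin_three, Matrix.of_apply]
    fun_prop
  · intro L t
    have h : ∀ i j, ent (ContinuousLinearMap.id ℝ E3 + t • L) i j
        = (if i = j then 1 else 0) + t * ent L i j := by
      intro i j
      simp [ent]
    rw [det_eq_ent]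
    simp only [Matrix.det_fin_three, Matrix.of_apply, h]
    simp
    ring

lemma no_retract (r : E3 → E3) (hr : ContDiff ℝ 1 r) (hn : ∀ x, ‖r x‖ = 2)
    (hb : ∀ x, ‖x‖ = 2 → r x = x) : False := by
  obtain ⟨q1, q2, q3, hq1, hq2, hq3, hdet⟩ := det_expand
  set B : Set E3 := closedBall 0 2 with hB
  have hBc : IsCompact B := isCompact_closedBall _ _
  set h : E3 → E3 := fun x => r x - x with hh
  have hhc : ContDiff ℝ 1 h := by fun_prop
  have hD : Continuous (fderiv ℝ h) := hhc.continuous_fderiv (by norm_num)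
  have hd : ∀ x, HasFDerivAt h (fderiv ℝ h x) x := fun x =>
    (hhc.differentiable (by norm_num) x).hasFDerivAt
  have hrd : ∀ x, HasFDerivAt r (fderiv ℝ r x) x := fun x =>
    (hr.differentiable (by norm_num) x).hasFDerivAt
  -- bounds
  obtain ⟨C, hC⟩ := hBc.exists_bound_of_continuousOn hD.continuousOn
  obtain ⟨C1, hC1⟩ := hBc.exists_bound_of_continuousOn (hq1.comp hD).continuousOn
  obtain ⟨C2, hC2⟩ := hBc.exists_bound_of_continuousOn (hq2.comp hD).continuousOn
  obtain ⟨C3, hC3⟩ := hBc.exists_bound_of_continuousOn (hq3.comp hD).continuousOn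
  set K : ℝ := 1 + |C| + |C1| + |C2| + |C3| with hK
  have hK1 : 1 ≤ K := by rw [hK]; linarith [abs_nonneg C, abs_nonneg C1, abs_nonneg C2, abs_nonneg C3]
  have hKC : ∀ x ∈ B, ‖fderiv ℝ h x‖ ≤ K := fun x hx => by
    have := hC x hx
    linarith [le_abs_self C, abs_nonneg C, abs_nonneg C1, abs_nonneg C2, abs_nonneg C3]
  have hK1' : ∀ x ∈ B, |q1 (fderiv ℝ h x)| ≤ K := fun x hx => by
    have := hC1 x hx
    simp only [Function.comp, Real.norm_eq_abs] at this
    linarith [le_abs_self C1, abs_nonneg C, abs_nonneg C1, abs_nonneg C2, abs_nonneg C3]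
  have hK2' : ∀ x ∈ B, |q2 (fderiv ℝ h x)| ≤ K := fun x hx => by
    have := hC2 x hx
    simp only [Function.comp, Real.norm_eq_abs] at this
    linarith [le_abs_self C2, abs_nonneg C, abs_nonneg C1, abs_nonneg C2, abs_nonneg C3]
  have hK3' : ∀ x ∈ B, |q3 (fderiv ℝ h x)| ≤ K := fun x hx => by
    have := hC3 x hx
    simp only [Function.comp, Real.norm_eq_abs] at this
    linarith [le_abs_self C3, abs_nonneg C, abs_nonneg C1, abs_nonneg C2, abs_nonneg C3]
  clear_value K
  have hK0 : 0 < K := by linarith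
  have hlip : ∀ x ∈ B, ∀ y ∈ B, ‖h x - h y‖ ≤ K * ‖x - y‖ := by
    intro x hx y hy
    exact (convex_closedBall (0 : E3) 2).norm_image_sub_le_of_norm_hasFDerivWithin_le
      (fun z _ => (hd z).hasFDerivWithinAt) (fun z hz => hKC z hz) hy hx
  have hsph : ∀ x : E3, ‖x‖ = 2 → h x = 0 := fun x hx => by simp [hh, hb x hx]
  -- the extension by zero
  set g : E3 → E3 := fun x => if ‖x‖ ≤ 2 then h x else 0 with hg
  have hmix : ∀ x y : E3, ‖x‖ ≤ 2 → 2 < ‖y‖ → ‖h x‖ ≤ K * ‖x - y‖ := by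
    intro x y hx hy
    have hcont : ContinuousOn (fun s : ℝ => ‖x + s • (y - x)‖) (Icc 0 1) := by fun_prop
    have := intermediate_value_Icc (zero_le_one) hcont
    obtain ⟨s, hs, hs2⟩ := this (show (2 : ℝ) ∈ _ by
      simp only [zero_smul, add_zero, one_smul, add_sub_cancel, mem_Icc]
      exact ⟨hx, hy.le⟩)
    simp only at hs2
    have h1 := hlip x (by simpa [hB] using hx) (x + s • (y - x)) (by simp [hB, hs2])
    rw [hsph _ hs2, sub_zero] at h1
    refine h1.trans ?_
    gcongr
    have : x - (x + s • (y - x)) = s • (x - y) := by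
      rw [smul_sub, smul_sub]; abel
    rw [this, norm_smul, Real.norm_of_nonneg hs.1]
    exact mul_le_of_le_one_left (norm_nonneg _) hs.2
  have hglip : ∀ x y, ‖g x - g y‖ ≤ K * ‖x - y‖ := by
    intro x y
    by_cases hx : ‖x‖ ≤ 2 <;> by_cases hy : ‖y‖ ≤ 2
    · simp only [hg, hx, hy, if_true]
      exact hlip x (by simpa [hB] using hx) y (by simpa [hB] using hy)
    · simp only [hg, hx, hy, if_true, if_false, sub_zero]
      exact hmix x y hx (not_le.1 hy)
    · rw [norm_sub_rev, norm_sub_rev x y]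
      simp only [hg, hx, hy, if_true, if_false, sub_zero]
      exact hmix y x hy (not_le.1 hx)
    · simp only [hg, hx, hy, if_false, sub_zero, norm_zero]
      positivity
  -- the volume identity
  have hvol : ∀ t : ℝ, 0 < t → t * K ≤ 1 / 4 →
      ∫ x in B, (1 + t * q1 (fderiv ℝ h x) + t ^ 2 * q2 (fderiv ℝ h x)
        + t ^ 3 * q3 (fderiv ℝ h x)) = volume.real B := by
    intro t ht htK
    have ht1 : t ≤ 1 / 4 := by nlinarith
    set f : E3 → E3 := fun x => x + t • h x with hf
    have hfd : ∀ x, HasFDerivAt f (ContinuousLinearMap.id ℝ E3 + t • fderiv ℝ h x) x := fun x =>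
      (hasFDerivAt_id x).add ((hd x).const_smul t)
    have hinj : InjOn f B := by
      intro x hx y hy hxy
      have h1 : x - y = t • (h y - h x) := by
        simp only [hf] at hxy
        rw [smul_sub, sub_eq_sub_iff_add_eq_add, hxy]; abel
      have h2 : ‖x - y‖ ≤ 1 / 4 * ‖x - y‖ := by
        calc ‖x - y‖ = t * ‖h y - h x‖ := by
              rw [h1, norm_smul, Real.norm_of_nonneg ht.le]
          _ ≤ t * (K * ‖y - x‖) := by gcongr; exact hlip y hy x hx
          _ = (t * K) * ‖x - y‖ := by rw [norm_sub_rev]; ring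
          _ ≤ _ := by gcongr
      have h3 : ‖x - y‖ = 0 := by linarith [norm_nonneg (x - y)]
      exact sub_eq_zero.1 (norm_eq_zero.1 h3)
    have himg : f '' B = B := by
      apply Subset.antisymm
      · rintro _ ⟨x, hx, rfl⟩
        have hx' : ‖x‖ ≤ 2 := by simpa [hB] using hx
        have : f x = (1 - t) • x + t • r x := by
          simp only [hf, hh, smul_sub, sub_smul, one_smul]; abel
        rw [this]
        simp only [hB, mem_closedBall, dist_zero_right]
        calc _ ≤ ‖(1 - t) • x‖ + ‖t • r x‖ := norm_add_le _ _
          _ = (1 - t) * ‖x‖ + t * 2 := by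
            rw [norm_smul, norm_smul, Real.norm_of_nonneg ht.le,
              Real.norm_of_nonneg (by linarith), hn]
          _ ≤ 2 := by nlinarith
      · intro y hy
        have hcw : ContractingWith (1 / 4) (fun x => y - t • g x) := by
          refine ⟨by rw [← NNReal.coe_lt_coe]; norm_num, LipschitzWith.of_dist_le_mul ?_⟩
          intro u v
          rw [dist_eq_norm, dist_eq_norm]
          have : y - t • g u - (y - t • g v) = t • (g v - g u) := by rw [smul_sub]; abel
          rw [this, norm_smul, Real.norm_of_nonneg ht.le]
          calc t * ‖g v - g u‖ ≤ t * (K * ‖v - u‖) := by gcongr; exact hglip v u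
            _ = (t * K) * ‖u - v‖ := by rw [norm_sub_rev]; ring
            _ ≤ _ := by push_cast; gcongr
        have hfix := hcw.fixedPoint_isFixedPt
        set x := ContractingWith.fixedPoint _ hcw
        have hx : y - t • g x = x := hfix
        by_cases hx2 : ‖x‖ ≤ 2
        · refine ⟨x, by simpa [hB] using hx2, ?_⟩
          simp only [hg, hx2, if_true] at hx
          simp only [hf]
          nth_rewrite 1 [← hx]
          abel
        · exfalso
          simp only [hg, hx2, if_false, smul_zero, sub_zero] at hx
          apply hx2
          rw [← hx]
          simpa [hB] using hy
    have hcv := integral_image_eq_integral_abs_det_fderiv_smul volume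
      (isClosed_closedBall.measurableSet : MeasurableSet B)
      (fun x _ => (hfd x).hasFDerivWithinAt) hinj (fun _ => (1 : ℝ))
    rw [himg] at hcv
    have hl : ∫ _x in B, (1 : ℝ) = volume.real B := by simp
    rw [← hl, hcv]
    apply setIntegral_congr_fun isClosed_closedBall.measurableSet
    intro x hx
    simp only [smul_eq_mul, mul_one]
    rw [← hdet, abs_of_nonneg]
    rw [hdet]
    have e1 := abs_le.1 (hK1' x hx)
    have e2 := abs_le.1 (hK2' x hx)
    have e3 := abs_le.1 (hK3' x hx)
    have a1 : -(t * K) ≤ t * q1 (fderiv ℝ h x) := by nlinarith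
    have a2 : -(t ^ 2 * K) ≤ t ^ 2 * q2 (fderiv ℝ h x) := by nlinarith [sq_nonneg t]
    have a3 : -(t ^ 3 * K) ≤ t ^ 3 * q3 (fderiv ℝ h x) := by
      nlinarith [pow_pos ht 3]
    have b2 : t ^ 2 * K ≤ 1 / 4 := by nlinarith
    have b3 : t ^ 3 * K ≤ 1 / 4 := by
      have : t ^ 3 * K = t * (t ^ 2 * K) := by ring
      nlinarith [mul_pos (pow_pos ht 2) hK0]
    linarith
  have hIntg : ∀ q : (E3 →L[ℝ] E3) → ℝ, Continuous q →
      IntegrableOn (fun x => q (fderiv ℝ h x)) B := fun q hq =>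
    (hq.comp hD).continuousOn.integrableOn_compact hBc
  have hexp : ∀ t : ℝ, ∫ x in B, (1 + t * q1 (fderiv ℝ h x) + t ^ 2 * q2 (fderiv ℝ h x)
        + t ^ 3 * q3 (fderiv ℝ h x)) = volume.real B + t * (∫ x in B, q1 (fderiv ℝ h x))
        + t ^ 2 * (∫ x in B, q2 (fderiv ℝ h x)) + t ^ 3 * (∫ x in B, q3 (fderiv ℝ h x)) := by
    intro t
    have i0 : IntegrableOn (fun _ : E3 => (1 : ℝ)) B :=
      continuousOn_const.integrableOn_compact hBc
    have i1 := (hIntg q1 hq1).const_mul t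
    have i2 := (hIntg q2 hq2).const_mul (t ^ 2)
    have i3 := (hIntg q3 hq3).const_mul (t ^ 3)
    have i01 : Integrable (fun x => 1 + t * q1 (fderiv ℝ h x)) (volume.restrict B) := i0.add i1
    have i012 : Integrable (fun x => 1 + t * q1 (fderiv ℝ h x) + t ^ 2 * q2 (fderiv ℝ h x))
      (volume.restrict B) := i01.add i2
    rw [integral_add i012 i3, integral_add i01 i2, integral_add i0 i1]
    simp only [integral_const_mul]
    simp
  set I1 := ∫ x in B, q1 (fderiv ℝ h x)
  set I2 := ∫ x in B, q2 (fderiv ℝ h x)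
  set I3 := ∫ x in B, q3 (fderiv ℝ h x)
  -- at time one the determinant vanishes
  have hone : volume.real B + I1 + I2 + I3 = 0 := by
    have := hexp 1
    simp only [one_mul, one_pow] at this
    rw [← this]
    rw [← integral_zero E3 ℝ (μ := volume.restrict B)]
    congr 1
    ext x
    have h1 := hdet (fderiv ℝ h x) 1
    simp only [one_mul, one_pow, one_smul] at h1
    rw [← h1]
    have h2 : fderiv ℝ h x = fderiv ℝ r x - ContinuousLinearMap.id ℝ E3 :=
      ((hrd x).sub (hasFDerivAt_id x)).fderiv
    rw [h2, add_sub_cancel]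
    by_contra hne
    have hsurj : Function.Surjective (fderiv ℝ r x) := by
      have hu : IsUnit (LinearMap.det (fderiv ℝ r x : E3 →ₗ[ℝ] E3)) :=
        isUnit_iff_ne_zero.2 hne
      exact (LinearEquiv.ofIsUnitDet (v := (EuclideanSpace.basisFun (Fin 3) ℝ).toBasis) (v' := (EuclideanSpace.basisFun (Fin 3) ℝ).toBasis) (f := (fderiv ℝ r x : E3 →ₗ[ℝ] E3)) (by
        rw [LinearMap.det_toMatrix]; exact hu)).surjective
    obtain ⟨v, hv⟩ := hsurj (r x)
    have h3 : HasFDerivAt (fun y => ‖r y‖ ^ 2) (0 : E3 →L[ℝ] ℝ) x := by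
      have : (fun y => ‖r y‖ ^ 2) = fun _ => (4 : ℝ) := by
        ext y; rw [hn]; norm_num
      rw [this]
      exact hasFDerivAt_const _ _
    have h4 := (hrd x).norm_sq.unique h3
    have h5 := congrArg (fun L => L v) h4
    simp [hv] at h5
    have := hn x
    rw [h5] at this
    simp at this
  have hpos : 0 < volume.real B := by
    apply ENNReal.toReal_pos
    · exact (measure_closedBall_pos volume _ (by norm_num)).ne'
    · exact hBc.measure_lt_top.ne
  set τ : ℝ := 1 / (12 * K) with hτ
  have hτ0 : 0 < τ := by positivity
  have hτK : τ * K = 1 / 12 := by rw [hτ]; field_simp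
  have v1 := hvol τ hτ0 (by rw [hτK]; norm_num)
  have v2 := hvol (2 * τ) (by positivity) (by rw [mul_assoc, hτK]; norm_num)
  have v3 := hvol (3 * τ) (by positivity) (by rw [mul_assoc, hτK]; norm_num)
  rw [hexp] at v1 v2 v3
  clear_value τ I1 I2 I3
  have w1 : τ * (I1 + τ * I2 + τ ^ 2 * I3) = 0 := by linear_combination v1
  have w2 : τ * (2 * I1 + 4 * τ * I2 + 8 * τ ^ 2 * I3) = 0 := by linear_combination v2
  have w3 : τ * (3 * I1 + 9 * τ * I2 + 27 * τ ^ 2 * I3) = 0 := by linear_combination v3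
  have u1 := (mul_eq_zero.1 w1).resolve_left hτ0.ne'
  have u2 := (mul_eq_zero.1 w2).resolve_left hτ0.ne'
  have u3 := (mul_eq_zero.1 w3).resolve_left hτ0.ne'
  have z3 : τ ^ 2 * I3 = 0 := by linarith
  have z2 : τ * I2 = 0 := by linarith
  have z1 : I1 = 0 := by linarith
  have y3 := (mul_eq_zero.1 z3).resolve_left (by positivity)
  have y2 := (mul_eq_zero.1 z2).resolve_left hτ0.ne'
  rw [z1, y2, y3] at hone
  linarith

open scoped Manifold ContDiff in
lemma no_field (F : E3 → E3) (hF : Continuous F) (h0 : ∀ x, F x ≠ 0)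
    (h1 : ∀ x : E3, 1 < ‖x‖ → 0 < inner ℝ x (F x)) : False := by
  have key : ∃ g : C^(1 : ℕ∞)⟮𝓘(ℝ, E3), E3; 𝓘(ℝ, E3), E3⟯, ∀ x,
      g x ∈ {v : E3 | 0 < inner ℝ v (F x) ∧ (2 ≤ ‖x‖ → v = x)} := by
    apply exists_contMDiffMap_forall_mem_convex_of_local 𝓘(ℝ, E3)
    · intro x v hv w hw α β hα hβ hαβ
      refine ⟨?_, fun hx => ?_⟩
      · rw [inner_add_left, real_inner_smul_left, real_inner_smul_left]
        have := hv.1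
        have := hw.1
        rcases hα.eq_or_lt with h | h
        · have : β = 1 := by linarith
          subst this; rw [← h]; linarith
        · have := mul_pos h hv.1
          have := mul_nonneg hβ hw.1.le
          linarith
      · rw [hv.2 hx, hw.2 hx, ← add_smul, hαβ, one_smul]
    · intro x
      by_cases hx : ‖x‖ < 2
      · refine ⟨{y | ‖y‖ < 2 ∧ 0 < inner ℝ (F x) (F y)}, ?_, fun _ => F x, contMDiffOn_const, ?_⟩
        · apply IsOpen.mem_nhds
          · have o1 : IsOpen {y : E3 | ‖y‖ < 2} := isOpen_lt continuous_norm continuous_const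
            have o2 : IsOpen {y : E3 | (0 : ℝ) < inner ℝ (F x) (F y)} :=
              isOpen_lt continuous_const (continuous_const.inner hF)
            exact o1.inter o2
          · exact ⟨hx, real_inner_self_pos.2 (h0 x)⟩
        · rintro y ⟨hy, hy2⟩
          exact ⟨hy2, fun h => absurd hy (not_lt.2 h)⟩
      · refine ⟨{y | 1 < ‖y‖}, ?_, id, contMDiff_id.contMDiffOn, ?_⟩
        · apply IsOpen.mem_nhds
          · exact isOpen_lt continuous_const continuous_norm
          · show 1 < ‖x‖
            linarith
        · intro y hy
          exact ⟨h1 y hy, fun _ => rfl⟩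
  obtain ⟨g, hg⟩ := key
  have hgs : ContDiff ℝ 1 g := g.contMDiff.contDiff
  have hg0 : ∀ x, g x ≠ 0 := fun x hx => by
    have := (hg x).1
    rw [hx, inner_zero_left] at this
    exact lt_irrefl _ this
  refine no_retract (fun x => (2 * ‖g x‖⁻¹) • g x) ?_ ?_ ?_
  · have : ContDiff ℝ 1 (fun x => ‖g x‖⁻¹) :=
      (hgs.norm ℝ hg0).inv fun x => norm_ne_zero_iff.2 (hg0 x)
    exact (contDiff_const.mul this).smul hgs
  · intro x
    have := norm_pos_iff.2 (hg0 x)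
    rw [norm_smul, Real.norm_of_nonneg (by positivity)]
    field_simp
  · intro x hx
    have : g x = x := (hg x).2 hx.ge
    simp [this, hx]

lemma lift_contra (T : E3 → E3 →L[ℝ] E3) (hT : ContinuousOn T (closedBall 0 1))
    (hδ : ∀ x ∈ closedBall (0 : E3) 1, ∀ v, ‖T x (T x v) - T x v‖ ≤ 1 / 12 * ‖v‖)
    (hs : ∀ x : E3, ‖x‖ = 1 → ∀ v, T x v = (inner ℝ x v : ℝ) • x)
    (u : E3) (hu : u ≠ 0) (hu3 : 1 / 3 * ‖u‖ ≤ ‖T 0 u‖) : False := by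
  set p : E3 → E3 := fun x => (max 1 ‖x‖)⁻¹ • x with hp
  have hmx : ∀ x : E3, 0 < max 1 ‖x‖ := fun x => lt_max_of_lt_left one_pos
  have hpc : Continuous p := by
    have : Continuous (fun x : E3 => (max 1 ‖x‖)⁻¹) :=
      (continuous_const.max continuous_norm).inv₀ fun x => (hmx x).ne'
    exact this.smul continuous_id
  have hpB : ∀ x, p x ∈ closedBall (0 : E3) 1 := fun x => by
    simp only [hp, mem_closedBall, dist_zero_right, norm_smul, norm_inv]
    rw [Real.norm_of_nonneg (hmx x).le, inv_mul_le_iff₀ (hmx x), mul_one]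
    exact le_max_right _ _
  have hpid : ∀ x ∈ closedBall (0 : E3) 1, p x = x := fun x hx => by
    have : ‖x‖ ≤ 1 := by simpa using hx
    simp [hp, max_eq_left this]
  have hTc : Continuous (fun x => T (p x)) := hT.comp_continuous hpc hpB
  have huc := (isCompact_closedBall (0 : E3) 1).uniformContinuousOn_of_continuous hT
  rw [Metric.uniformContinuousOn_iff] at huc
  obtain ⟨d, hd, hd2⟩ := huc (1 / 4) (by norm_num)
  obtain ⟨m, hm⟩ := exists_nat_one_div_lt hd
  set N : ℝ := (m : ℝ) + 1 with hN
  have hNpos : 0 < N := by positivity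
  let w : ℕ → E3 → E3 := fun k => Nat.rec (fun _ => T 0 u)
    (fun k wk x => T (p (((k + 1 : ℕ) / N : ℝ) • x)) (wk x)) k
  have w0 : ∀ x, w 0 x = T 0 u := fun _ => rfl
  have ws : ∀ k x, w (k + 1) x = T (p (((k + 1 : ℕ) / N : ℝ) • x)) (w k x) := fun _ _ => rfl
  have wc : ∀ k, Continuous (w k) := by
    intro k
    induction k with
    | zero => exact continuous_const
    | succ k ih =>
      have : Continuous (fun x : E3 => T (p (((k + 1 : ℕ) / N : ℝ) • x))) :=
        hTc.comp (continuous_const_smul (((k + 1 : ℕ) / N : ℝ)))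
      exact this.clm_apply ih
  have hsc : ∀ k : ℕ, k ≤ m + 1 → ∀ x ∈ closedBall (0 : E3) 1,
      ((k : ℝ) / N) • x ∈ closedBall (0 : E3) 1 := by
    intro k hk x hx
    have hx1 : ‖x‖ ≤ 1 := by simpa using hx
    have hk' : (k : ℝ) / N ≤ 1 := by
      rw [div_le_one hNpos, hN]; exact_mod_cast hk
    simp only [mem_closedBall, dist_zero_right, norm_smul]
    rw [Real.norm_of_nonneg (by positivity)]
    exact mul_le_one₀ hk' (norm_nonneg _) hx1
  have hinv : ∀ k : ℕ, k ≤ m + 1 → ∀ x ∈ closedBall (0 : E3) 1, w k x ≠ 0 ∧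
      ‖T (((k : ℝ) / N) • x) (w k x) - w k x‖ ≤ 1 / 4 * ‖w k x‖ := by
    intro k
    induction k with
    | zero =>
      intro _ x hx
      have hup : 0 < ‖u‖ := norm_pos_iff.2 hu
      refine ⟨?_, ?_⟩
      · rw [w0]
        exact norm_pos_iff.1 (by linarith)
      · rw [w0]
        simp only [Nat.cast_zero, zero_div, zero_smul]
        have := hδ 0 (by simp) u
        linarith
    | succ k ih =>
      intro hk x hx
      obtain ⟨i1, i2⟩ := ih (by omega) x hx
      have b1 := hsc k (by omega) x hx
      have b2 := hsc (k + 1) hk x hx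
      have hx1 : ‖x‖ ≤ 1 := by simpa using hx
      have hdist : dist (((k + 1 : ℕ) / N : ℝ) • x) (((k : ℝ) / N) • x) < d := by
        rw [dist_eq_norm, ← sub_smul, norm_smul]
        have : ((k + 1 : ℕ) / N : ℝ) - (k : ℝ) / N = 1 / N := by push_cast; ring
        rw [this, Real.norm_of_nonneg (by positivity)]
        calc 1 / N * ‖x‖ ≤ 1 / N * 1 := by gcongr
          _ < d := by rw [mul_one]; exact hm
      have hTT := hd2 _ b2 _ b1 hdist
      rw [dist_eq_norm] at hTT
      rw [ws, hpid _ b2]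
      set S := T (((k + 1 : ℕ) / N : ℝ) • x)
      set S' := T (((k : ℝ) / N) • x)
      set v := w k x
      have hv : 0 < ‖v‖ := norm_pos_iff.2 i1
      have e1 : ‖S v - S' v‖ ≤ 1 / 4 * ‖v‖ := by
        rw [← _root_.sub_apply]
        exact ((S - S').le_opNorm v).trans (by gcongr)
      have e2 : ‖v‖ ≤ ‖S v‖ + ‖S v - S' v‖ + ‖S' v - v‖ := by
        have : v = S v - (S v - S' v) - (S' v - v) := by abel
        calc ‖v‖ = ‖S v - (S v - S' v) - (S' v - v)‖ := by rw [← this]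
          _ ≤ ‖S v - (S v - S' v)‖ + ‖S' v - v‖ := norm_sub_le _ _
          _ ≤ _ := by gcongr; exact norm_sub_le _ _
      have e3 := hδ _ b2 v
      refine ⟨norm_pos_iff.1 (by linarith), ?_⟩
      change ‖S (S v) - S v‖ ≤ _
      change ‖S (S v) - S v‖ ≤ _ at e3
      linarith
  -- the final field
  have hN1 : ((m + 1 : ℕ) : ℝ) / N = 1 := by rw [hN]; push_cast; exact div_self hNpos.ne'
  set G : E3 → E3 := w (m + 1) with hG
  have hGc : Continuous G := wc (m + 1)
  have hG0 : ∀ x ∈ closedBall (0 : E3) 1, G x ≠ 0 := fun x hx => (hinv (m + 1) le_rfl x hx).1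
  have hGs : ∀ x : E3, ‖x‖ = 1 → G x = (inner ℝ x (G x) : ℝ) • x := by
    intro x hx
    have : G x = (inner ℝ x (w m x) : ℝ) • x := by
      rw [hG, ws, hN1, one_smul, hpid x (by simp [hx]), hs x hx]
    rw [this, real_inner_smul_right, real_inner_self_eq_norm_sq, hx]
    simp
  have hne : ∀ x : E3, ‖x‖ = 1 → inner ℝ x (G x) ≠ (0 : ℝ) := by
    intro x hx h
    have := hGs x hx
    rw [h, zero_smul] at this
    exact hG0 x (by simp [hx]) this
  have hpre : IsPreconnected (sphere (0 : E3) 1) :=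
    isPreconnected_sphere (by rw [← Module.finrank_eq_rank]; simp) 0 1
  have hfin : ∀ σ : ℝ, σ ≠ 0 → (∀ x : E3, ‖x‖ = 1 → 0 < σ * inner ℝ x (G x)) → False := by
    intro σ hσ hpos
    refine no_field (fun x => σ • G (p x)) ((hGc.comp hpc).const_smul σ) ?_ ?_
    · intro x
      exact smul_ne_zero hσ (hG0 _ (hpB x))
    · intro x hx
      have hx0 : 0 < ‖x‖ := by linarith
      have hpx : p x = ‖x‖⁻¹ • x := by simp [hp, max_eq_right hx.le]
      have hn : ‖p x‖ = 1 := by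
        rw [hpx, norm_smul, norm_inv, norm_norm, inv_mul_cancel₀ hx0.ne']
      have hxp : x = ‖x‖ • p x := by
        rw [hpx, smul_smul, mul_inv_cancel₀ hx0.ne', one_smul]
      have h2 := hpos (p x) hn
      rw [real_inner_smul_right]
      nth_rewrite 1 [hxp]
      rw [real_inner_smul_left]
      have := mul_pos hx0 h2
      linarith
  have hic : Continuous (fun x : E3 => (inner ℝ x (G x) : ℝ)) := continuous_id.inner hGc
  by_cases hall : ∀ x : E3, ‖x‖ = 1 → (0 : ℝ) < inner ℝ x (G x)
  · exact hfin 1 one_ne_zero fun x hx => by simpa using hall x hx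
  · push Not at hall
    obtain ⟨x0, hx0, hx0'⟩ := hall
    refine hfin (-1) (by norm_num) fun x hx => ?_
    by_contra hcon
    have hx' : (0 : ℝ) ≤ inner ℝ x (G x) := by linarith
    obtain ⟨z, hz, hz0⟩ := hpre.intermediate_value (by simpa using hx0) (by simpa using hx)
      hic.continuousOn ⟨hx0', hx'⟩
    exact hne z (by simpa using hz) hz0

lemma sstar_pos (a b c : ℝ) (hb : 0 < b) (hc : 0 < c) : 0 < sstar a b c := by
  unfold sstar
  have := Real.sqrt_nonneg (b ^ 2 + 24 * a * c)
  positivity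

lemma sstar_eq (a b c : ℝ) (ha : 0 ≤ a) (hc : 0 < c) :
    2 * c * sstar a b c ^ 2 = b * sstar a b c + 3 * a := by
  unfold sstar
  have h := Real.sq_sqrt (show 0 ≤ b ^ 2 + 24 * a * c by positivity)
  set R := Real.sqrt (b ^ 2 + 24 * a * c)
  clear_value R
  set R := Real.sqrt (b ^ 2 + 24 * a * c)
  clear_value R
  field_simp
  linear_combination 2 * h

/-- Newton inequality for symmetric matrices with trace one. -/
lemma newton_ineq (x y z p q r e2 e3 : ℝ) (htr : x + y + z = 1)
    (he2 : e2 = x * y + x * z + y * z - p ^ 2 - q ^ 2 - r ^ 2)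
    (he3 : e3 = x * y * z + 2 * p * q * r - x * r ^ 2 - y * q ^ 2 - z * p ^ 2) :
    3 * e3 ≤ e2 ^ 2 := by
  have hid : e2 ^ 2 - 3 * ((x + y + z) * e3) =
      1 / 2 * (((y * z - r ^ 2) - (x * z - q ^ 2)) ^ 2 + ((y * z - r ^ 2) - (x * y - p ^ 2)) ^ 2
        + ((x * z - q ^ 2) - (x * y - p ^ 2)) ^ 2) + 3 * ((q * r - p * z) ^ 2
        + (p * r - q * y) ^ 2 + (p * q - r * x) ^ 2) := by
    rw [he2, he3]; ring
  rw [htr, one_mul] at hid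
  have : 0 ≤ e2 ^ 2 - 3 * e3 := by rw [hid]; positivity
  linarith

lemma fbulk_lower (a b c : ℝ) (ha : 0 ≤ a) (hb : 0 < b) (hc : 0 < c) (Q : M3) (hQ : Q ∈ S0) :
    b * sstar a b c ^ 3 / 8 *
      frobSq (((sstar a b c)⁻¹ • Q + (1 / 3 : ℝ) • (1 : M3)) *
        ((sstar a b c)⁻¹ • Q + (1 / 3 : ℝ) • (1 : M3))
        - ((sstar a b c)⁻¹ • Q + (1 / 3 : ℝ) • (1 : M3))) ≤ fbulk a b c Q := by
  have hs := sstar_pos a b c hb hc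
  have hse := sstar_eq a b c ha hc
  obtain ⟨hsym, htr⟩ := hQ
  unfold fbulk kconst
  set s := sstar a b c
  clear_value s
  obtain ⟨A, hA⟩ : ∃ A : M3, A = s⁻¹ • Q + (1 / 3 : ℝ) • (1 : M3) := ⟨_, rfl⟩
  have hQA : Q = s • (A - (1 / 3 : ℝ) • (1 : M3)) := by
    rw [hA, add_sub_cancel_right, smul_smul, mul_inv_cancel₀ hs.ne', one_smul]
  rw [← hA]
  have hAsym : ∀ i j, A i j = A j i := by
    intro i j
    rw [hA]
    have := hsym.apply i j
    simp [Matrix.one_apply, this, eq_comm]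
  have hAtr : A 0 0 + A 1 1 + A 2 2 = 1 := by
    rw [hA]
    rw [Matrix.trace_fin_three] at htr
    simp
    linear_combination s⁻¹ * htr
  clear hA htr hsym
  rw [hQA]
  obtain ⟨x, hx⟩ : ∃ x, x = A 0 0 := ⟨_, rfl⟩
  obtain ⟨y, hy⟩ : ∃ x, x = A 1 1 := ⟨_, rfl⟩
  obtain ⟨z, hz⟩ : ∃ x, x = A 2 2 := ⟨_, rfl⟩
  obtain ⟨p, hp⟩ : ∃ x, x = A 0 1 := ⟨_, rfl⟩
  obtain ⟨q, hq⟩ : ∃ x, x = A 0 2 := ⟨_, rfl⟩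
  obtain ⟨r, hr⟩ : ∃ x, x = A 1 2 := ⟨_, rfl⟩
  have hAm : A = !![x, p, q; p, y, r; q, r, z] := by
    ext i j
    fin_cases i <;> fin_cases j <;> simp [hx, hy, hz, hp, hq, hr, hAsym 1 0, hAsym 2 0, hAsym 2 1]
  rw [← hx, ← hy, ← hz] at hAtr
  clear hx hy hz hp hq hr hAsym hQA
  subst hAm
  have hz : z = 1 - x - y := by linarith
  obtain ⟨e2, he2⟩ : ∃ e, e = x * y + x * z + y * z - p ^ 2 - q ^ 2 - r ^ 2 := ⟨_, rfl⟩
  obtain ⟨e3, he3⟩ : ∃ e, e = x * y * z + 2 * p * q * r - x * r ^ 2 - y * q ^ 2 - z * p ^ 2 :=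
    ⟨_, rfl⟩
  have hnew := newton_ineq x y z p q r e2 e3 hAtr he2 he3
  have hfrob : frobSq (!![x, p, q; p, y, r; q, r, z] * !![x, p, q; p, y, r; q, r, z]
      - !![x, p, q; p, y, r; q, r, z]) = 2 * e2 ^ 2 - 2 * e3 := by
    simp only [frobSq, Fin.sum_univ_three, Matrix.sub_apply, Matrix.mul_apply]
    simp
    rw [he2, he3, hz]
    ring
  have ht2 : (s • (!![x, p, q; p, y, r; q, r, z] - (1 / 3 : ℝ) • (1 : M3)) *
      s • (!![x, p, q; p, y, r; q, r, z] - (1 / 3 : ℝ) • (1 : M3))).trace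
      = s ^ 2 * (2 / 3 - 2 * e2) := by
    simp only [Matrix.trace_fin_three, Matrix.mul_apply, Fin.sum_univ_three, Matrix.smul_apply,
      Matrix.sub_apply, Matrix.one_apply]
    simp
    rw [he2, hz]
    ring
  have ht3 : (s • (!![x, p, q; p, y, r; q, r, z] - (1 / 3 : ℝ) • (1 : M3)) *
      s • (!![x, p, q; p, y, r; q, r, z] - (1 / 3 : ℝ) • (1 : M3)) *
      s • (!![x, p, q; p, y, r; q, r, z] - (1 / 3 : ℝ) • (1 : M3))).trace
      = s ^ 3 * (2 / 9 - e2 + 3 * e3) := by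
    simp only [Matrix.trace_fin_three, Matrix.mul_apply, Fin.sum_univ_three, Matrix.smul_apply,
      Matrix.sub_apply, Matrix.one_apply]
    simp
    rw [he2, he3, hz]
    ring
  rw [hfrob, ht2, ht3]
  clear hfrob ht2 ht3 he2 he3
  have haeq : a = (2 * c * s ^ 2 - b * s) / 3 := by linarith
  have hcs : b ≤ 2 * c * s := by
    have : 0 ≤ s * (2 * c * s - b) := by nlinarith
    have := nonneg_of_mul_nonneg_right this hs
    linarith
  have hf : s ^ 2 / 27 * (9 * a + 2 * b * s - 3 * c * s ^ 2) - a / 2 * (s ^ 2 * (2 / 3 - 2 * e2)) -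
      b / 3 * (s ^ 3 * (2 / 9 - e2 + 3 * e3)) + c / 4 * (s ^ 2 * (2 / 3 - 2 * e2)) ^ 2
      = b * s ^ 3 * (-e3) + c * s ^ 4 * e2 ^ 2 := by
    rw [haeq]; ring
  rw [hf]
  have h1 : b * (s ^ 3 * e2 ^ 2) ≤ 2 * c * s * (s ^ 3 * e2 ^ 2) := by gcongr
  have h2 : b * s ^ 3 * (3 * e3) ≤ b * s ^ 3 * e2 ^ 2 := by gcongr
  linarith

/-- A matrix as a continuous linear map. -/
def opM (A : M3) : E3 →L[ℝ] E3 := Matrix.toEuclideanCLM (n := Fin 3) (𝕜 := ℝ) A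

lemma opM_bound (A : M3) (v : E3) : ‖opM A v‖ ^ 2 ≤ frobSq A * ‖v‖ ^ 2 := by
  have h : ∀ i, opM A v i = ∑ j, A i j * v j := by
    intro i
    simp [opM, Matrix.mulVec, dotProduct]
  rw [EuclideanSpace.norm_sq_eq, EuclideanSpace.norm_sq_eq, frobSq, Finset.sum_mul]
  apply Finset.sum_le_sum
  intro i _
  rw [h, Real.norm_eq_abs, sq_abs]
  simp only [Real.norm_eq_abs, sq_abs]
  exact Finset.sum_mul_sq_le_sq_mul_sq _ _ _

/-- any continuous extension of the hedgehog boundary data has a point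
with definitely positive bulk energy. -/
theorem stmt18 (a b c : ℝ) (ha : 0 ≤ a) (hb : 0 < b) (hc : 0 < c) :
    ∃ η : ℝ, 0 < η ∧
      ∀ Q : E3 → M3,
        ContinuousOn Q (closedBall (0 : E3) 1) →
        (∀ x ∈ closedBall (0 : E3) 1, Q x ∈ S0) →
        (∀ x ∈ sphere (0 : E3) 1,
          Q x = sstar a b c • (Matrix.vecMulVec (fun i => x i) (fun i => x i) - (1 / 3 : ℝ) • (1 : M3))) →
        ∃ y ∈ ball (0 : E3) 1, η ≤ fbulk a b c (Q y) := by
  have hs := sstar_pos a b c hb hc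
  refine ⟨b * sstar a b c ^ 3 / 8 * (1 / 144), by positivity, ?_⟩
  intro Q hQc hQS hQb
  by_contra hcon
  push Not at hcon
  set s := sstar a b c with hsdef
  set A : E3 → M3 := fun x => s⁻¹ • Q x + (1 / 3 : ℝ) • (1 : M3) with hA
  have hAb : ∀ x : E3, ‖x‖ = 1 → A x = Matrix.vecMulVec (fun i => x i) (fun i => x i) := by
    intro x hx
    simp only [hA]
    rw [hQb x (by simpa using hx), smul_smul, inv_mul_cancel₀ hs.ne', one_smul, sub_add_cancel]
  have hAap : ∀ x : E3, ‖x‖ = 1 → ∀ v, opM (A x) v = (inner ℝ x v : ℝ) • x := by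
    intro x hx v
    rw [hAb x hx]
    ext i
    simp [opM, Matrix.mulVec, dotProduct, Matrix.vecMulVec, Fin.sum_univ_three,
      PiLp.inner_apply]
    ring
  have hAc : ContinuousOn (fun x => opM (A x)) (closedBall (0 : E3) 1) := by
    have h1 : ContinuousOn A (closedBall (0 : E3) 1) := (hQc.const_smul s⁻¹).add continuousOn_const
    have h2 : Continuous opM :=
      LinearMap.continuous_of_finiteDimensional
        ((Matrix.toEuclideanCLM (n := Fin 3) (𝕜 := ℝ)).toAlgEquiv.toLinearMap)
    exact h2.comp_continuousOn h1
  have hu : ∃ u : E3, u ≠ 0 ∧ 1 / 3 * ‖u‖ ≤ ‖opM (A 0) u‖ := by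
    have htr : A 0 0 0 + A 0 1 1 + A 0 2 2 = 1 := by
      have htr := (hQS 0 (by simp)).2
      rw [Matrix.trace_fin_three] at htr
      simp [hA]
      linear_combination s⁻¹ * htr
    have key : ∀ i : Fin 3, 1 / 3 ≤ A 0 i i →
        ∃ u : E3, u ≠ 0 ∧ 1 / 3 * ‖u‖ ≤ ‖opM (A 0) u‖ := by
      intro i hi
      refine ⟨EuclideanSpace.single i 1, by simp, ?_⟩
      have h1 : opM (A 0) (EuclideanSpace.single i 1) i = A 0 i i := by
        simp [opM]
      have h2 := PiLp.norm_apply_le (opM (A 0) (EuclideanSpace.single i 1)) i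
      rw [h1] at h2
      have h3 := le_abs_self (A 0 i i)
      rw [Real.norm_eq_abs] at h2
      simp only [EuclideanSpace.norm_single, norm_one]
      linarith
    by_cases c0 : 1 / 3 ≤ A 0 0 0
    · exact key 0 c0
    by_cases c1 : 1 / 3 ≤ A 0 1 1
    · exact key 1 c1
    exact key 2 (by push Not at c0 c1; linarith)
  obtain ⟨u, hu0, hu3⟩ := hu
  refine lift_contra (fun x => opM (A x)) hAc ?_ hAap u hu0 hu3
  intro x hx v
  have hx1 : ‖x‖ ≤ 1 := by simpa using hx
  rcases hx1.eq_or_lt with h | h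
  · simp only [hAap x h]
    rw [real_inner_smul_right, real_inner_self_eq_norm_sq, h]
    simp
  · have h1 := hcon x (by simpa using h)
    have h2 := fbulk_lower a b c ha hb hc (Q x) (hQS x hx)
    have h3 : frobSq (A x * A x - A x) ≤ 1 / 144 := by
      have h4 := (h2.trans_lt h1).le
      exact le_of_mul_le_mul_left h4 (by positivity)
    have h5 : opM (A x) (opM (A x) v) - opM (A x) v = opM (A x * A x - A x) v := by
      simp [opM, map_sub, map_mul]
    show ‖opM (A x) (opM (A x) v) - opM (A x) v‖ ≤ _
    rw [h5]
    have h6 := opM_bound (A x * A x - A x) v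
    apply abs_le_of_sq_le_sq' _ (by positivity) |>.2
    calc _ ≤ _ := h6
      _ ≤ 1 / 144 * ‖v‖ ^ 2 := by gcongr
      _ = _ := by ring

end
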